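/- There exist an absolute constant c > 0 and a function m : ℝ → ℕ such that the following holds. Let K ≥ 1, let G be a nilpotent group, and let A be a K-approximate subgroup of G. Then there exist subgroups H and C of G with H normal in C such that: (a) H ⊆ A^{m(K)}; (b) C/H is nilpotent of nilpotency class at most K^6; (c) C is generated by A^6 ∩ C; (d) |A^2 ∩ C| ≥ exp(−K^c)·|A|; (e) A can be covered by at most exp(K^c) left cosets of C. -/

import Mathlib

open Pointwise

/-- A finite symmetric subset `A` (with `1 ∈ A`) of a group `G` is a `K`-approximate
subgroup if there is a set `X ⊆ G` with `|X| ≤ K` and `A·A ⊆ X·A`. -/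
def IsKApproximateSubgroup {G : Type*} [Group G] (K : ℝ) (A : Set G) : Prop :=
  A.Finite ∧ A⁻¹ = A ∧ (1 : G) ∈ A ∧
    ∃ X : Set G, X.Finite ∧ (X.ncard : ℝ) ≤ K ∧ A * A ⊆ X * A

namespace ApproximateSubgroup

open scoped commutatorElement

variable {G : Type*} [Group G] {A : Set G} {K : ℝ} {C H L M N P Q V W : Subgroup G}

/-- Every element of `N` lies in the product set `E * H`. -/
def Covers (E : Set G) (H N : Subgroup G) : Prop := ∀ x ∈ N, ∃ w ∈ H, x * w⁻¹ ∈ E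

/-- Conjugation by elements of `C` maps `N` into itself. -/
def Normalizes (C N : Subgroup G) : Prop := ∀ c ∈ C, ∀ x ∈ N, c * x * c⁻¹ ∈ N

/-- `H ∩ A ^ t` contains `n` elements whose translates of `A` are pairwise disjoint. -/
def HasSeparated (A : Set G) (t : ℕ) (H : Subgroup G) (n : ℕ) : Prop :=
  ∃ Y : Finset G, Y.card = n ∧ (∀ y ∈ Y, y ∈ A ^ t ∧ y ∈ H) ∧
    ∀ y ∈ Y, ∀ z ∈ Y, y ≠ z → y * z⁻¹ ∉ A ^ 2

/-- There is an increasing chain of subgroups from `H` to `N`, each of which is covered by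
translates of the previous one by elements of `A ^ u`. -/
def Reaches (A : Set G) (u : ℕ) : Subgroup G → Subgroup G → Prop :=
  Relation.ReflTransGen fun H N => H ≤ N ∧ Covers (A ^ u) H N

lemma inv_mem_pow (hA : IsApproximateSubgroup K A) {m : ℕ} {x : G} (hx : x ∈ A ^ m) :
    x⁻¹ ∈ A ^ m := by
  have h : (A ^ m)⁻¹ = A ^ m := by rw [← inv_pow, hA.inv_eq_self]
  rw [← h]
  simpa using hx

lemma finite_pow (hfin : A.Finite) (n : ℕ) : (A ^ n).Finite := by
  induction n with
  | zero => simp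
  | succ n ih => exact pow_succ A n ▸ ih.mul hfin

lemma mem_pow_mono (hA : IsApproximateSubgroup K A) {m n : ℕ} (hmn : m ≤ n) {x : G}
    (hx : x ∈ A ^ m) : x ∈ A ^ n :=
  Set.pow_subset_pow_right hA.one_mem hmn hx

lemma mul_mem_pow {m n : ℕ} {x y : G} (hx : x ∈ A ^ m) (hy : y ∈ A ^ n) :
    x * y ∈ A ^ (m + n) := by
  rw [pow_add]
  exact Set.mul_mem_mul hx hy

lemma commutatorElement_mem_pow (hA : IsApproximateSubgroup K A) {m n : ℕ} {x y : G}
    (hx : x ∈ A ^ m) (hy : y ∈ A ^ n) : ⁅x, y⁆ ∈ A ^ (m + n + m + n) :=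
  mul_mem_pow (mul_mem_pow (mul_mem_pow hx hy) (inv_mem_pow hA hx)) (inv_mem_pow hA hy)

lemma Covers.trans {s t : ℕ} (h₁ : Covers (A ^ s) H N) (h₂ : Covers (A ^ t) N P) :
    Covers (A ^ (t + s)) H P := by
  intro x hx
  obtain ⟨y, hy, hxy⟩ := h₂ x hx
  obtain ⟨w, hw, hyw⟩ := h₁ y hy
  exact ⟨w, hw, by simpa using mul_mem_pow hxy hyw⟩

lemma Covers.mono_pow (hA : IsApproximateSubgroup K A) {s t : ℕ} (hst : s ≤ t)
    (h : Covers (A ^ s) H N) : Covers (A ^ t) H N := fun x hx =>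
  let ⟨w, hw, hxw⟩ := h x hx
  ⟨w, hw, mem_pow_mono hA hst hxw⟩

lemma Covers.le_closure (hA : IsApproximateSubgroup K A) {s t : ℕ} (hst : s ≤ t)
    (hHN : H ≤ N) (hH : H ≤ Subgroup.closure (A ^ t ∩ (H : Set G)))
    (h : Covers (A ^ s) H N) : N ≤ Subgroup.closure (A ^ t ∩ (N : Set G)) := by
  intro x hx
  obtain ⟨w, hw, hxw⟩ := h x hx
  have h₁ : x * w⁻¹ ∈ Subgroup.closure (A ^ t ∩ (N : Set G)) :=
    Subgroup.subset_closure ⟨mem_pow_mono hA hst hxw, N.mul_mem hx (N.inv_mem (hHN hw))⟩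
  have h₂ : w ∈ Subgroup.closure (A ^ t ∩ (N : Set G)) :=
    Subgroup.closure_mono (Set.inter_subset_inter_right _ hHN) (hH hw)
  simpa using Subgroup.mul_mem _ h₁ h₂

lemma Normalizes.conj_inv_mem (h : Normalizes C N) {c x : G} (hc : c ∈ C) (hx : x ∈ N) :
    c⁻¹ * x * c ∈ N := by
  simpa using h c⁻¹ (C.inv_mem hc) x hx

lemma Normalizes.commutatorElement_mem (h : Normalizes C N) {c x : G} (hc : c ∈ C) (hx : x ∈ N) :
    ⁅x, c⁆ ∈ N := by
  have := N.mul_mem hx (h c hc _ (N.inv_mem hx))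
  simpa [commutatorElement_def, mul_assoc] using this

lemma normalizes_of_commutatorElement_mem (h : ∀ x ∈ N, ∀ c ∈ C, ⁅x, c⁆ ∈ N) :
    Normalizes C N := by
  intro c hc x hx
  have := N.mul_mem (N.inv_mem (h x hx c hc)) hx
  simpa [commutatorElement_def, mul_assoc] using this

lemma commutatorElement_mem_of_swap {x y : G} (h : ⁅x, y⁆ ∈ N) : ⁅y, x⁆ ∈ N := by
  simpa using N.inv_mem h

lemma card_le_of_separated (hA : IsApproximateSubgroup K A) (hfin : A.Finite) {t : ℕ}
    (Y : Finset G) (hY : ∀ y ∈ Y, y ∈ A ^ t)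
    (hsep : ∀ y ∈ Y, ∀ z ∈ Y, y ≠ z → y * z⁻¹ ∉ A ^ 2) : (Y.card : ℝ) ≤ K ^ t := by
  classical
  lift A to Finset G using hfin
  have hcard : A.card * Y.card ≤ (A ^ (t + 1)).card := by
    rw [← Finset.card_product]
    refine Finset.card_le_card_of_injOn (fun p => p.1 * p.2) ?_ ?_
    · rintro ⟨a, y⟩ hp
      simp only [Finset.coe_product, Set.mem_prod, Finset.mem_coe] at hp
      have : a * y ∈ (A : Set G) ^ (t + 1) := by
        rw [pow_succ']
        exact Set.mul_mem_mul hp.1 (hY y hp.2)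
      exact_mod_cast this
    · rintro ⟨a, y⟩ hp ⟨b, z⟩ hq hab
      simp only [Finset.coe_product, Set.mem_prod, Finset.mem_coe] at hp hq hab
      by_cases hyz : y = z
      · subst hyz
        simpa using hab
      · refine absurd ?_ (hsep y hp.2 z hq.2 hyz)
        have h1 : y * z⁻¹ = a⁻¹ * b := by
          rw [mul_inv_eq_iff_eq_mul, mul_assoc, ← hab, inv_mul_cancel_left]
        rw [h1, sq]
        refine Set.mul_mem_mul ?_ hq.1
        simpa using inv_mem_pow hA (m := 1) (by simpa using hp.1)
  have hpow := hA.card_pow_le (n := t + 1)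
  have hpos : (0 : ℝ) < A.card := by
    exact_mod_cast Finset.card_pos.2 ⟨1, hA.one_mem⟩
  have : (A.card : ℝ) * Y.card ≤ K ^ t * A.card := by
    calc (A.card : ℝ) * Y.card ≤ (A ^ (t + 1)).card := by exact_mod_cast hcard
      _ ≤ K ^ t * A.card := by simpa using hpow
  nlinarith

lemma HasSeparated.le_floor (hA : IsApproximateSubgroup K A) (hfin : A.Finite) {t n : ℕ}
    (h : HasSeparated A t H n) : n ≤ ⌊K ^ t⌋₊ := by
  obtain ⟨Y, rfl, hY, hsep⟩ := h
  exact Nat.le_floor (card_le_of_separated hA hfin Y (fun y hy => (hY y hy).1) hsep)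

lemma HasSeparated.mono {t n : ℕ} (h : HasSeparated A t H n) (hHN : H ≤ N) :
    HasSeparated A t N n := by
  obtain ⟨Y, hn, hY, hsep⟩ := h
  exact ⟨Y, hn, fun y hy => ⟨(hY y hy).1, hHN (hY y hy).2⟩, hsep⟩

lemma HasSeparated.succ (hA : IsApproximateSubgroup K A) {t n : ℕ} (h : HasSeparated A t H n)
    (hHN : H ≤ N) {x : G} (hxA : x ∈ A ^ t) (hxN : x ∈ N) (hx : ∀ w ∈ H, x * w⁻¹ ∉ A ^ 2) :
    HasSeparated A t N (n + 1) := by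
  classical
  obtain ⟨Y, hn, hY, hsep⟩ := h
  have hxY : x ∉ Y := fun hmem => hx x (hY x hmem).2 <| by
    simpa using mem_pow_mono hA (Nat.zero_le 2) (x := 1) (by simp)
  refine ⟨insert x Y, by rw [Finset.card_insert_of_notMem hxY, hn], ?_, ?_⟩
  · intro y hy
    rcases Finset.mem_insert.1 hy with rfl | hy
    · exact ⟨hxA, hxN⟩
    · exact ⟨(hY y hy).1, hHN (hY y hy).2⟩
  · intro y hy z hz hyz
    rcases Finset.mem_insert.1 hy with rfl | hyY <;> rcases Finset.mem_insert.1 hz with rfl | hzY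
    · exact absurd rfl hyz
    · exact hx z (hY z hzY).2
    · intro hmem
      exact hx y (hY y hyY).2 (by simpa using inv_mem_pow hA hmem)
    · exact hsep y hyY z hzY hyz

lemma Reaches.covers_or_exists {u : ℕ} (h : Reaches A u L V) (hA : IsApproximateSubgroup K A) :
    Covers (A ^ u) L V ∨ ∃ N, L ≤ N ∧ Reaches A u N V ∧ Covers (A ^ (u + u)) L N ∧
      ∃ x ∈ N, ∀ w ∈ L, x * w⁻¹ ∉ A ^ u := by
  have hle : L ≤ V := by
    induction h with
    | refl => exact le_rfl
    | tail _ h ih => exact ih.trans h.1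
  induction h with
  | refl =>
    left
    intro x hx
    exact ⟨x, hx, by simpa using mem_pow_mono hA (Nat.zero_le u) (x := 1) (by simp)⟩
  | @tail V V' hV hVV' ih =>
    have hLV : L ≤ V := by
      clear ih hle hVV'
      induction hV with
      | refl => exact le_rfl
      | tail _ h ih => exact ih.trans h.1
    rcases ih hLV with hcov | ⟨N, hLN, hNV, hcov, hx⟩
    · by_cases hV' : Covers (A ^ u) L V'
      · exact Or.inl hV'
      · refine Or.inr ⟨V', hle, Relation.ReflTransGen.refl, hcov.trans hVV'.2, ?_⟩
        unfold Covers at hV'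
        push Not at hV'
        exact hV'
    · exact Or.inr ⟨N, hLN, hNV.tail hVV', hcov, hx⟩

lemma Reaches.covers (hA : IsApproximateSubgroup K A) (hfin : A.Finite) {u : ℕ} (hu : 2 ≤ u)
    (n : ℕ) {p : ℕ} (hsep : HasSeparated A (u + u) L p) (hn : ⌊K ^ (u + u)⌋₊ ≤ p + n)
    (h : Reaches A u L V) : Covers (A ^ ((u + u) * n + u)) L V := by
  induction n generalizing L p with
  | zero =>
    rcases h.covers_or_exists hA with hcov | ⟨N, hLN, hNV, hcov, x, hxN, hx⟩
    · simpa using hcov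
    · obtain ⟨w, hw, hxw⟩ := hcov x hxN
      have := (hsep.succ hA hLN hxw (N.mul_mem hxN (N.inv_mem (hLN hw))) fun w' hw' hmem =>
        hx (w' * w) (L.mul_mem hw' hw) (mem_pow_mono hA hu
          (by simpa [mul_assoc] using hmem))).le_floor hA hfin
      omega
  | succ n ih =>
    rcases h.covers_or_exists hA with hcov | ⟨N, hLN, hNV, hcov, x, hxN, hx⟩
    · exact hcov.mono_pow hA (by omega)
    · obtain ⟨w, hw, hxw⟩ := hcov x hxN
      have := hsep.succ hA hLN hxw (N.mul_mem hxN (N.inv_mem (hLN hw))) fun w' hw' hmem =>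
        hx (w' * w) (L.mul_mem hw' hw) (mem_pow_mono hA hu (by simpa [mul_assoc] using hmem))
      exact (hcov.trans (ih this (by omega) hNV)).mono_pow hA (by rw [mul_add]; omega)

lemma exists_subgroup_of_commutatorElement (hA : IsApproximateSubgroup K A) {s t : ℕ}
    (hPQ : P ≤ Q) (hQC : Q ≤ C) (hQP : ∀ x ∈ Q, ∀ c ∈ C, ⁅x, c⁆ ∈ P) (hMP : M ≤ P)
    (hcov : Covers (A ^ t) M Q) {g : G} (hgA : g ∈ A ^ s) (hgC : g ∈ C)
    (hWP : W ≤ P) (hPW : ∀ x ∈ P, ∀ c ∈ C, ⁅x, c⁆ ∈ W) (hWQ : W ≤ ⁅Q, C⁆) :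
    ∃ W', W ≤ W' ∧ W' ≤ ⁅Q, C⁆ ∧ Covers (A ^ (t + s + t + s)) W W' ∧ ∀ x ∈ Q, ⁅x, g⁆ ∈ W' := by
  have hW : Normalizes C W :=
    normalizes_of_commutatorElement_mem fun x hx c hc => hPW x (hWP hx) c hc
  have hPC := hPQ.trans hQC
  refine ⟨⟨⟨⟨{y | ∃ x ∈ Q, ⁅x, g⁆⁻¹ * y ∈ W}, ?_⟩, ?_⟩, ?_⟩, ?_, ?_, ?_, ?_⟩
  · rintro y z ⟨x, hx, hy⟩ ⟨x', hx', hz⟩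
    refine ⟨x' * x, Q.mul_mem hx' hx, ?_⟩
    have hxg := hQP x hx g hgC
    have h₁ : ⁅x', ⁅x, g⁆⁻¹⁆ ∈ W :=
      commutatorElement_mem_of_swap (hPW _ (P.inv_mem hxg) x' (hQC hx'))
    have h₂ := hW.conj_inv_mem (hPC (hQP x' hx' g hgC)) (W.mul_mem h₁ hy)
    have := W.mul_mem h₂ hz
    convert this using 1
    simp only [commutatorElement_def]
    group
  · exact ⟨1, Q.one_mem, by simp⟩
  · rintro y ⟨x, hx, hy⟩
    refine ⟨x⁻¹, Q.inv_mem hx, ?_⟩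
    have hxg := hQP x hx g hgC
    have h₁ : ⁅x⁻¹, ⁅x, g⁆⁆ ∈ W :=
      commutatorElement_mem_of_swap (hPW _ hxg x⁻¹ (C.inv_mem (hQC hx)))
    have := W.mul_mem h₁ (hW _ (hPC hxg) _ (W.inv_mem hy))
    change ⁅x⁻¹, g⁆⁻¹ * y⁻¹ ∈ W
    convert this using 1
    simp only [commutatorElement_def]
    group
  · exact fun w hw => ⟨1, Q.one_mem, by simpa using hw⟩
  · rintro y ⟨x, hx, hy⟩
    have := Subgroup.mul_mem _ (Subgroup.commutator_mem_commutator hx hgC) (hWQ hy)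
    rwa [mul_inv_cancel_left] at this
  · rintro y ⟨x, hx, hy⟩
    obtain ⟨m, hm, he⟩ := hcov x hx
    have heQ : x * m⁻¹ ∈ Q := Q.mul_mem hx (Q.inv_mem (hPQ (hMP hm)))
    have h₁ := hW _ (hQC heQ) _ (hPW m (hMP hm) g hgC)
    have h₂ := hW.conj_inv_mem (hPC (hQP _ heQ g hgC)) h₁
    refine ⟨_, W.mul_mem h₂ hy, ?_⟩
    have h₃ := commutatorElement_mem_pow hA he hgA
    convert h₃ using 1
    simp only [commutatorElement_def]
    group
  · refine fun x hx => ⟨x, hx, ?_⟩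
    rw [inv_mul_cancel]
    exact W.one_mem

lemma reaches_commutator (hA : IsApproximateSubgroup K A) (hfin : A.Finite) {s t : ℕ}
    (hC : C ≤ Subgroup.closure (A ^ s ∩ (C : Set G)))
    (hPQ : P ≤ Q) (hQC : Q ≤ C) (hQP : ∀ x ∈ Q, ∀ c ∈ C, ⁅x, c⁆ ∈ P) (hMP : M ≤ P)
    (hcov : Covers (A ^ t) M Q) : Reaches A (t + s + t + s) ⁅P, C⁆ ⁅Q, C⁆ := by
  classical
  have hQP' : ⁅Q, C⁆ ≤ P := Subgroup.commutator_le.2 hQP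
  have key : ∀ S : Finset G, (∀ g ∈ S, g ∈ A ^ s ∧ g ∈ C) → ∃ W, ⁅P, C⁆ ≤ W ∧ W ≤ ⁅Q, C⁆ ∧
      Reaches A (t + s + t + s) ⁅P, C⁆ W ∧ ∀ g ∈ S, ∀ x ∈ Q, ⁅x, g⁆ ∈ W := by
    intro S
    induction S using Finset.induction_on with
    | empty =>
      exact fun _ => ⟨⁅P, C⁆, le_rfl, Subgroup.commutator_mono hPQ le_rfl,
        Relation.ReflTransGen.refl, by simp⟩
    | insert g S _ ih =>
      intro hS
      obtain ⟨W, hPW, hWQ, hr, hSW⟩ := ih fun g hg => hS g (Finset.mem_insert_of_mem hg)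
      obtain ⟨hgA, hgC⟩ := hS g (Finset.mem_insert_self g S)
      obtain ⟨W', hWW', hW'Q, hcov', hg⟩ := exists_subgroup_of_commutatorElement hA hPQ hQC hQP
        hMP hcov hgA hgC (hWQ.trans hQP')
        (fun x hx c hc => hPW (Subgroup.commutator_mem_commutator hx hc)) hWQ
      refine ⟨W', hPW.trans hWW', hW'Q, hr.tail ⟨hWW', hcov'⟩, fun g' hg' x hx => ?_⟩
      rcases Finset.mem_insert.1 hg' with rfl | hg'
      · exact hg x hx
      · exact hWW' (hSW g' hg' x hx)
  have hS : (A ^ s ∩ (C : Set G)).Finite := (finite_pow hfin s).subset Set.inter_subset_left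
  obtain ⟨W, hPW, hWQ, hr, hSW⟩ := key hS.toFinset fun g hg => hS.mem_toFinset.1 hg
  have hW : Normalizes C W := normalizes_of_commutatorElement_mem fun x hx c hc =>
    hPW (Subgroup.commutator_mem_commutator (hQP' (hWQ hx)) hc)
  have hCle : Subgroup.closure (A ^ s ∩ (C : Set G)) ≤ C :=
    (Subgroup.closure_le _).2 Set.inter_subset_right
  have hQW : ⁅Q, C⁆ ≤ W := by
    refine Subgroup.commutator_le.2 fun x hx c hc => ?_
    induction hC hc using Subgroup.closure_induction with
    | mem g hg => exact hSW g (hS.mem_toFinset.2 hg) x hx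
    | one => simp
    | mul a b ha hb iha ihb =>
      have := W.mul_mem (iha (hCle ha)) (hW a (hCle ha) _ (ihb (hCle hb)))
      convert this using 1
      simp only [commutatorElement_def]
      group
    | inv a ha iha =>
      have := hW.conj_inv_mem (hCle ha) (W.inv_mem (iha (hCle ha)))
      convert this using 1
      simp only [commutatorElement_def]
      group
  rwa [le_antisymm hQW hWQ]

/-- The terms of the lower central series of the whole group. -/
local notation "γ" => Subgroup.lowerCentralSeries (⊤ : Subgroup _)

lemma commutatorElement_mem_lowerCentralSeries_sup (j : ℕ) (hN : Normalizes C N) {x c : G}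
    (hx : x ∈ γ j ⊔ N) (hc : c ∈ C) : ⁅x, c⁆ ∈ γ (j + 1) ⊔ N := by
  obtain ⟨y, hy, n, hn, rfl⟩ := Subgroup.mem_sup_of_normal_left.1 hx
  have hcomm : ∀ g, ⁅y, g⁆ ∈ γ (j + 1) := fun g =>
    Subgroup.commutator_mem_commutator hy (Subgroup.mem_top g)
  have h₁ := hN.commutatorElement_mem hc hn
  have := Subgroup.mul_mem _ (Subgroup.mul_mem_sup (hcomm ⁅n, c⁆) h₁)
    (Subgroup.mem_sup_left (T := N) (hcomm c))
  convert this using 1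
  simp only [commutatorElement_def]
  group

lemma reaches_commutator_of_lowerCentralSeries (hA : IsApproximateSubgroup K A) (hfin : A.Finite)
    {s t : ℕ} (hC : C ≤ Subgroup.closure (A ^ s ∩ (C : Set G))) (hMN : M ≤ N) (hNC : N ≤ C)
    (hM : Normalizes C M) (hN : Normalizes C N) (hcov : Covers (A ^ t) M N) (i j : ℕ)
    (hij : γ (j + i) = (⊥ : Subgroup G)) :
    Reaches A (t + s + t + s) ⁅M, C⁆ ⁅(γ j ⊔ M) ⊓ N, C⁆ := by
  induction i generalizing j with
  | zero =>
    rw [add_zero] at hij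
    rw [hij, bot_sup_eq, inf_eq_left.2 hMN]
    exact Relation.ReflTransGen.refl
  | succ i ih =>
    refine (ih (j + 1) (by rw [← hij]; congr 1; omega)).trans
      (reaches_commutator hA hfin hC ?_ (inf_le_right.trans hNC) ?_
        (le_inf le_sup_right hMN) fun x hx => hcov x hx.2)
    · gcongr
      exact Subgroup.lowerCentralSeries_antitone (⊤ : Subgroup G) (Nat.le_succ j)
    · exact fun x hx c hc => ⟨commutatorElement_mem_lowerCentralSeries_sup j hM hx.1 hc,
        hN.commutatorElement_mem hc hx.2⟩

/-- If `N` is covered by boundedly many steps of `A` over `M`, then so is `⁅N, C⁆` over `⁅M, C⁆`. -/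
lemma Covers.commutator (hA : IsApproximateSubgroup K A) (hfin : A.Finite)
    (hG : Group.IsNilpotent G) {t u : ℕ} (hu : u = t + 6 + t + 6)
    (hC : C ≤ Subgroup.closure (A ^ 6 ∩ (C : Set G))) (hMN : M ≤ N) (hNC : N ≤ C)
    (hM : Normalizes C M) (hN : Normalizes C N) (hcov : Covers (A ^ t) M N) :
    Covers (A ^ ((u + u) * ⌊K ^ (u + u)⌋₊ + u)) ⁅M, C⁆ ⁅N, C⁆ := by
  obtain ⟨n, hn⟩ := Subgroup.nilpotent_iff_lowerCentralSeries.1 hG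
  have h := reaches_commutator_of_lowerCentralSeries hA hfin hC hMN hNC hM hN hcov n 0
    (by simpa using hn)
  rw [Subgroup.lowerCentralSeries_zero, top_sup_eq, top_inf_eq, ← hu] at h
  exact h.covers hA hfin (by omega) (p := 0) _ ⟨∅, rfl, by simp, by simp⟩ (by simp)

/-- The elements of `C` that commute modulo `N` with every element of `S`. -/
def centralizerMod (C N : Subgroup G) (hN : Normalizes C N) (S : Set G) : Subgroup G where
  carrier := {x | x ∈ C ∧ ∀ s ∈ S, ⁅x, s⁆ ∈ N}
  mul_mem' {x y} hx hy := ⟨C.mul_mem hx.1 hy.1, fun s hs => by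
    have := N.mul_mem (hN x hx.1 _ (hy.2 s hs)) (hx.2 s hs)
    convert this using 1
    simp only [commutatorElement_def]
    group⟩
  one_mem' := ⟨C.one_mem, fun s _ => by simp⟩
  inv_mem' {x} hx := ⟨C.inv_mem hx.1, fun s hs => by
    have := hN.conj_inv_mem hx.1 (N.inv_mem (hx.2 s hs))
    convert this using 1
    simp only [commutatorElement_def]
    group⟩

/-- The number of left cosets of `C` that meet `A`. -/
noncomputable def cosetCount (A : Set G) (C : Subgroup G) : ℕ :=
  ((fun x : G => (x : G ⧸ C)) '' A).ncard

/-- The data carried by the iterative construction: `H` is normal in `C`, modulo `H` the group `C`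
is generated by `A ^ 2 ∩ C`, and `H` is generated by `A ^ 6 ∩ H`. -/
structure IsStage (A : Set G) (C H : Subgroup G) : Prop where
  le : H ≤ C
  normalizes : Normalizes C H
  le_closure_sup : C ≤ Subgroup.closure (A ^ 2 ∩ (C : Set G)) ⊔ H
  le_closure : H ≤ Subgroup.closure (A ^ 6 ∩ (H : Set G))

lemma normalizes_of_le_closure_sup (hA : IsApproximateSubgroup K A)
    (hC : C ≤ Subgroup.closure (A ^ 2 ∩ (C : Set G)) ⊔ N) (hNP : N ≤ P)
    (h : ∀ a ∈ A ^ 2, a ∈ C → ∀ x ∈ P, a * x * a⁻¹ ∈ P) : Normalizes C P := by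
  have hle : C ≤ Subgroup.normalizer (P : Set G) := by
    refine hC.trans (sup_le ((Subgroup.closure_le _).2 ?_) (hNP.trans Subgroup.le_normalizer))
    rintro a ⟨haA, haC⟩
    refine Subgroup.mem_normalizer_iff.2 fun x => ⟨h a haA haC x, fun hx => ?_⟩
    simpa [mul_assoc] using h a⁻¹ (inv_mem_pow hA haA) (C.inv_mem haC) _ hx
  exact fun c hc x hx => (Subgroup.mem_normalizer_iff.1 (hle hc) x).1 hx

lemma IsStage.exists_maximal (h : IsStage A C H) (hA : IsApproximateSubgroup K A)
    (hfin : A.Finite) : ∃ N, H ≤ N ∧ IsStage A C N ∧ Covers (A ^ 2) H N ∧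
      ∀ P, N ≤ P → P ≤ C → Normalizes C P → Covers (A ^ 2) H P → P ≤ N := by
  let S : Set (Subgroup G) := {N | H ≤ N ∧ N ≤ C ∧ Normalizes C N ∧ Covers (A ^ 2) H N}
  have hS : S.Finite := by
    refine Set.Finite.of_finite_image (f := fun N : Subgroup G => A ^ 2 ∩ (N : Set G))
      ((finite_pow hfin 2).finite_subsets.subset ?_) ?_
    · rintro _ ⟨N, -, rfl⟩
      exact Set.inter_subset_left
    · have key : ∀ N ∈ S, ∀ P ∈ S, A ^ 2 ∩ (N : Set G) = A ^ 2 ∩ (P : Set G) → N ≤ P := by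
        intro N hN P hP hNP x hx
        obtain ⟨w, hw, hxw⟩ := hN.2.2.2 x hx
        have : x * w⁻¹ ∈ A ^ 2 ∩ (P : Set G) :=
          hNP ▸ ⟨hxw, N.mul_mem hx (N.inv_mem (hN.1 hw))⟩
        simpa using P.mul_mem this.2 (hP.1 hw)
      exact fun N hN P hP hNP => le_antisymm (key N hN P hP hNP) (key P hP N hN hNP.symm)
  have hH : H ∈ S := ⟨le_rfl, h.le, h.normalizes, fun x hx =>
    ⟨x, hx, by simpa using mem_pow_mono hA (Nat.zero_le 2) (x := 1) (by simp)⟩⟩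
  obtain ⟨N, hN⟩ := hS.exists_maximal ⟨H, hH⟩
  obtain ⟨hHN, hNC, hnorm, hcov⟩ := hN.prop
  exact ⟨N, hHN, ⟨hNC, hnorm, h.le_closure_sup.trans (sup_le_sup_left hHN _),
    hcov.le_closure hA (by norm_num) hHN h.le_closure⟩, hcov,
    fun P hNP hPC hP hHP => hN.le_of_ge ⟨hHN.trans hNP, hPC, hP, hHP⟩ hNP⟩

lemma commutatorElement_inv_mul_mem (hN : Normalizes C N) {h x y : G} (hh : h ∈ C) (hx : x ∈ C)
    (hxy : ⁅x, h⁆⁻¹ * ⁅y, h⁆ ∈ N) : ⁅x⁻¹ * y, h⁆ ∈ N := by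
  have h₁ := hN (x⁻¹ * h⁻¹) (C.mul_mem (C.inv_mem hx) (C.inv_mem hh)) _ hxy
  have h₂ := hN h hh _ h₁
  convert h₂ using 1
  simp only [commutatorElement_def]
  group

lemma ncard_image_mk_le (hA : IsApproximateSubgroup K A) (hfin : A.Finite) {t : ℕ} {T : Set G}
    (hN : Normalizes C N) (hTA : T ⊆ A ^ t) (hTC : T ⊆ C)
    (hT : ∀ y ∈ T, ∀ z ∈ T, y * z⁻¹ ∈ A ^ 2 → y * z⁻¹ ∈ N) :
    (((fun x : G => (x : G ⧸ N)) '' T).ncard : ℝ) ≤ K ^ t := by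
  obtain ⟨Y, hYT, hY⟩ := Set.exists_subset_bijOn T (fun x : G => (x : G ⧸ N))
  have hYfin : Y.Finite := (finite_pow hfin t).subset (hYT.trans hTA)
  lift Y to Finset G using hYfin
  rw [← hY.image_eq, hY.injOn.ncard_image, Set.ncard_coe_finset]
  refine card_le_of_separated hA hfin Y (fun y hy => hTA (hYT hy)) fun y hy z hz hyz hmem => ?_
  refine hyz (hY.injOn hy hz (QuotientGroup.eq.2 ?_))
  have h₁ := hN.conj_inv_mem (hTC (hYT hy)) (N.inv_mem (hT y (hYT hy) z (hYT hz) hmem))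
  convert h₁ using 1
  group

lemma cosetCount_le (hA : IsApproximateSubgroup K A) (hfin : A.Finite) {P : Subgroup G} {h : G}
    (hN : Normalizes C N) (hhC : h ∈ C) (hhA : h ∈ A ^ 6)
    (hP : ∀ x ∈ A ^ 2, x ∈ C → ⁅x, h⁆ ∈ N → x ∈ P)
    (hcomm : ∀ x ∈ C, ∀ y ∈ C, ⁅x, h⁆ * ⁅y, h⁆⁻¹ ∈ A ^ 2 → ⁅x, h⁆ * ⁅y, h⁆⁻¹ ∈ N) :
    (cosetCount A P : ℝ) ≤ cosetCount A C * K ^ 16 := by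
  classical
  have hrep : ∀ q : G ⧸ C, ∃ r : G, (∃ a ∈ A, (a : G ⧸ C) = q) → r ∈ A ∧ (r : G ⧸ C) = q := by
    intro q
    by_cases hq : ∃ a ∈ A, (a : G ⧸ C) = q
    · exact ⟨hq.choose, fun _ => hq.choose_spec⟩
    · exact ⟨1, fun h => absurd h hq⟩
  choose r hr using hrep
  let F : G → (G ⧸ C) × (G ⧸ N) := fun a => ((a : G ⧸ C), (⁅(r a)⁻¹ * a, h⁆ : G))
  let T : Set G := (fun x => ⁅x, h⁆) '' (A ^ 2 ∩ (C : Set G))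
  have hrA : ∀ a ∈ A, (r a)⁻¹ * a ∈ A ^ 2 ∩ (C : Set G) := by
    intro a ha
    obtain ⟨h₁, h₂⟩ := hr a ⟨a, ha, rfl⟩
    refine ⟨?_, QuotientGroup.eq.1 h₂⟩
    have := mul_mem_pow (m := 1) (n := 1) (inv_mem_pow hA (by simpa using h₁)) (by simpa using ha)
    simpa using this
  have hT : (((fun x : G => (x : G ⧸ N)) '' T).ncard : ℝ) ≤ K ^ 16 := by
    refine ncard_image_mk_le hA hfin hN ?_ ?_ ?_
    · rintro _ ⟨x, ⟨hxA, -⟩, rfl⟩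
      simpa using commutatorElement_mem_pow hA hxA hhA
    · rintro _ ⟨x, ⟨-, hxC⟩, rfl⟩
      exact C.mul_mem (C.mul_mem (C.mul_mem hxC hhC) (C.inv_mem hxC)) (C.inv_mem hhC)
    · rintro _ ⟨x, ⟨-, hxC⟩, rfl⟩ _ ⟨y, ⟨-, hyC⟩, rfl⟩
      exact hcomm x hxC y hyC
  have hTfin : T.Finite := ((finite_pow hfin 2).subset Set.inter_subset_left).image _
  have hF : F '' A ⊆ ((fun x : G => (x : G ⧸ C)) '' A) ×ˢ ((fun x : G => (x : G ⧸ N)) '' T) := by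
    rintro _ ⟨a, ha, rfl⟩
    exact ⟨⟨a, ha, rfl⟩, ⟨_, ⟨_, hrA a ha, rfl⟩, rfl⟩⟩
  have hFP : ∀ a ∈ A, ∀ b ∈ A, F a = F b → (a : G ⧸ P) = b := by
    intro a ha b hb hab
    have h₁ : (a : G ⧸ C) = b := congrArg Prod.fst hab
    have h₂ := congrArg Prod.snd hab
    simp only [F, h₁] at h₂
    have h₃ := commutatorElement_inv_mul_mem hN hhC (h₁ ▸ (hrA a ha).2) (QuotientGroup.eq.1 h₂)
    have h₄ : ((r b)⁻¹ * a)⁻¹ * ((r b)⁻¹ * b) = a⁻¹ * b := by group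
    rw [h₄] at h₃
    refine QuotientGroup.eq.2 (hP _ ?_ (QuotientGroup.eq.1 h₁) h₃)
    have := mul_mem_pow (m := 1) (n := 1) (inv_mem_pow hA (by simpa using ha)) (by simpa using hb)
    simpa using this
  have hle : cosetCount A P ≤ (F '' A).ncard := by
    obtain ⟨Y, hYA, hY⟩ := Set.exists_subset_bijOn A (fun x : G => (x : G ⧸ P))
    rw [cosetCount, ← hY.image_eq, hY.injOn.ncard_image]
    refine Set.ncard_le_ncard_of_injOn F (fun a ha => ⟨a, hYA ha, rfl⟩) ?_ (hfin.image F)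
    exact fun a ha b hb hab => hY.injOn ha hb (hFP a (hYA ha) b (hYA hb) hab)
  have hle' : (F '' A).ncard ≤ cosetCount A C * ((fun x : G => (x : G ⧸ N)) '' T).ncard := by
    rw [cosetCount, ← Set.ncard_prod]
    exact Set.ncard_le_ncard hF ((hfin.image _).prod (hTfin.image _))
  calc (cosetCount A P : ℝ) ≤ cosetCount A C * ((fun x : G => (x : G ⧸ N)) '' T).ncard := by
        exact_mod_cast hle.trans hle'
    _ ≤ cosetCount A C * K ^ 16 := by gcongr

lemma IsStage.exists_central_extension (h : IsStage A C N) (hA : IsApproximateSubgroup K A)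
    (hfin : A.Finite) {j : ℕ} (hj : ∀ x ∈ A ^ 2, x ∈ C → x ∈ γ (j + 1) ⊔ N → x ∈ N)
    {g : G} (hgA : g ∈ A ^ 6) (hgC : g ∈ C) (hgj : g ∈ γ j ⊔ N) :
    ∃ C' H', IsStage A C' H' ∧ C' ≤ C ∧ N ≤ H' ∧ g ∈ H' ∧ (∀ x ∈ H', ∀ c ∈ C', ⁅x, c⁆ ∈ N) ∧
      (cosetCount A C' : ℝ) ≤ cosetCount A C * K ^ 16 := by
  let D := centralizerMod C N h.normalizes {g}
  let E := centralizerMod C N h.normalizes D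
  have hDC : D ≤ C := fun x hx => hx.1
  have hgD : g ∈ D := ⟨hgC, by rintro _ rfl; simp⟩
  have hND : N ≤ D := fun x hx => ⟨h.le hx, by
    rintro _ rfl
    exact h.normalizes.commutatorElement_mem hgC hx⟩
  have hgE : g ∈ E := ⟨hgC, fun c hc => commutatorElement_mem_of_swap (hc.2 g rfl)⟩
  have hNE : N ≤ E := fun x hx => ⟨h.le hx, fun c hc =>
    h.normalizes.commutatorElement_mem (hDC hc) hx⟩
  let H' := Subgroup.zpowers g ⊔ N
  have hgH' : g ∈ H' := Subgroup.mem_sup_left (Subgroup.mem_zpowers g)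
  have hNH' : N ≤ H' := le_sup_right
  have hH'D : H' ≤ D := sup_le ((Subgroup.zpowers_le).2 hgD) hND
  have hH'E : H' ≤ E := sup_le ((Subgroup.zpowers_le).2 hgE) hNE
  let C' := Subgroup.closure (A ^ 2 ∩ (D : Set G)) ⊔ H'
  have hC'D : C' ≤ D := sup_le ((Subgroup.closure_le _).2 Set.inter_subset_right) hH'D
  have hDC' : A ^ 2 ∩ (D : Set G) ⊆ C' := fun x hx =>
    Subgroup.mem_sup_left (Subgroup.subset_closure hx)
  have hcomm : ∀ x ∈ H', ∀ c ∈ C', ⁅x, c⁆ ∈ N := fun x hx c hc => (hH'E hx).2 c (hC'D hc)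
  refine ⟨C', H', ⟨le_sup_right, ?_, ?_, ?_⟩, hC'D.trans hDC, hNH', hgH', hcomm, ?_⟩
  · exact normalizes_of_commutatorElement_mem fun x hx c hc => hNH' (hcomm x hx c hc)
  · exact sup_le_sup_right
      (Subgroup.closure_mono (Set.subset_inter Set.inter_subset_left hDC')) _
  · refine sup_le ((Subgroup.zpowers_le).2 (Subgroup.subset_closure ⟨hgA, hgH'⟩)) ?_
    exact h.le_closure.trans (Subgroup.closure_mono (Set.inter_subset_inter_right _ hNH'))
  · refine cosetCount_le hA hfin h.normalizes hgC hgA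
      (fun x hxA hxC hxg => hDC' ⟨hxA, hxC, by rintro _ rfl; exact hxg⟩) ?_
    have hmem : ∀ x ∈ C, ⁅x, g⁆ ∈ C ∧ ⁅x, g⁆ ∈ γ (j + 1) ⊔ N := fun x hx =>
      ⟨C.mul_mem (C.mul_mem (C.mul_mem hx hgC) (C.inv_mem hx)) (C.inv_mem hgC),
        commutatorElement_mem_of_swap
          (commutatorElement_mem_lowerCentralSeries_sup j h.normalizes hgj hx)⟩
    exact fun x hx y hy hxy => hj _ hxy (C.mul_mem (hmem x hx).1 (C.inv_mem (hmem y hy).1))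
      (Subgroup.mul_mem _ (hmem x hx).2 (Subgroup.inv_mem _ (hmem y hy).2))

lemma IsStage.exists_covered_extension (h : IsStage A C N) (hA : IsApproximateSubgroup K A) {j : ℕ}
    (hj : ∀ x ∈ A ^ 6, x ∈ C → x ∈ γ j ⊔ N → ∃ w ∈ N, x * w⁻¹ ∈ A ^ 2) :
    ∃ P, N ≤ P ∧ P ≤ C ∧ Normalizes C P ∧ Covers (A ^ 2) N P ∧
      ∀ x ∈ A ^ 2, x ∈ C → x ∈ γ j ⊔ N → x ∈ P := by
  have hNj : N ≤ γ j ⊔ N := le_sup_right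
  let P : Subgroup G :=
    { carrier := {x | x ∈ C ∧ x ∈ γ j ⊔ N ∧ ∃ w ∈ N, x * w⁻¹ ∈ A ^ 2}
      one_mem' := ⟨C.one_mem, Subgroup.one_mem _, 1, N.one_mem, by
        simpa using mem_pow_mono hA (Nat.zero_le 2) (x := 1) (by simp)⟩
      mul_mem' := by
        rintro x y ⟨hxC, hxj, w, hw, hxw⟩ ⟨hyC, hyj, v, hv, hyv⟩
        have hyvC : y * v⁻¹ ∈ C := C.mul_mem hyC (C.inv_mem (h.le hv))
        obtain ⟨u, hu, hxyu⟩ := hj ((x * w⁻¹) * (y * v⁻¹))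
          (mem_pow_mono hA (by norm_num) (mul_mem_pow hxw hyv))
          (C.mul_mem (C.mul_mem hxC (C.inv_mem (h.le hw))) hyvC)
          (Subgroup.mul_mem _ (Subgroup.mul_mem _ hxj (Subgroup.inv_mem _ (hNj hw)))
            (Subgroup.mul_mem _ hyj (Subgroup.inv_mem _ (hNj hv))))
        refine ⟨C.mul_mem hxC hyC, Subgroup.mul_mem _ hxj hyj, _, N.mul_mem hu
          (N.mul_mem (h.normalizes.conj_inv_mem hyvC hw) hv), ?_⟩
        convert hxyu using 1
        group
      inv_mem' := by
        rintro x ⟨hxC, hxj, w, hw, hxw⟩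
        refine ⟨C.inv_mem hxC, Subgroup.inv_mem _ hxj, _,
          h.normalizes x hxC _ (N.inv_mem hw), ?_⟩
        simpa [mul_assoc] using inv_mem_pow hA hxw }
  have hNP : N ≤ P := fun x hx => ⟨h.le hx, hNj hx, x, hx, by
    simpa using mem_pow_mono hA (Nat.zero_le 2) (x := 1) (by simp)⟩
  refine ⟨P, hNP, fun x hx => hx.1, normalizes_of_le_closure_sup hA h.le_closure_sup hNP ?_,
    fun x hx => hx.2.2, fun x hxA hxC hxj => ⟨hxC, hxj, 1, N.one_mem, by simpa using hxA⟩⟩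
  rintro a haA haC x ⟨hxC, hxj, w, hw, hxw⟩
  have hconj : ∀ y ∈ γ j ⊔ N, a * y * a⁻¹ ∈ γ j ⊔ N := by
    intro y hy
    have h₁ := commutatorElement_mem_of_swap
      (commutatorElement_mem_lowerCentralSeries_sup j h.normalizes hy haC)
    have h₂ : γ (j + 1) ⊔ N ≤ γ j ⊔ N :=
      sup_le_sup_right (Subgroup.lowerCentralSeries_antitone (⊤ : Subgroup G) (Nat.le_succ j)) N
    have := Subgroup.mul_mem _ (h₂ h₁) hy
    simpa [commutatorElement_def] using this
  have hxwC : x * w⁻¹ ∈ C := C.mul_mem hxC (C.inv_mem (h.le hw))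
  obtain ⟨u, hu, hau⟩ := hj (a * (x * w⁻¹) * a⁻¹)
    (mul_mem_pow (mul_mem_pow haA hxw) (inv_mem_pow hA haA))
    (C.mul_mem (C.mul_mem haC hxwC) (C.inv_mem haC))
    (hconj _ (Subgroup.mul_mem _ hxj (Subgroup.inv_mem _ (hNj hw))))
  refine ⟨C.mul_mem (C.mul_mem haC hxC) (C.inv_mem haC), hconj x hxj, _,
    N.mul_mem hu (h.normalizes a haC w hw), ?_⟩
  convert hau using 1
  group

lemma exists_lowerCentralSeries_index (hG : Group.IsNilpotent G)
    {x : G} (hxA : x ∈ A ^ 2) (hxC : x ∈ C) (hxN : x ∉ N) :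
    ∃ j, (∃ y ∈ A ^ 2, y ∈ C ∧ y ∈ γ j ⊔ N ∧ y ∉ N) ∧
      ∀ y ∈ A ^ 2, y ∈ C → y ∈ γ (j + 1) ⊔ N → y ∈ N := by
  by_contra! hcon
  have key : ∀ j, ∃ y ∈ A ^ 2, y ∈ C ∧ y ∈ γ j ⊔ N ∧ y ∉ N := by
    intro j
    induction j with
    | zero => exact ⟨x, hxA, hxC, Subgroup.mem_sup_left (by simp), hxN⟩
    | succ j ih => exact hcon j ih
  obtain ⟨n, hn⟩ := Subgroup.nilpotent_iff_lowerCentralSeries.1 hG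
  obtain ⟨y, -, -, hy, hyN⟩ := key n
  rw [hn, bot_sup_eq] at hy
  exact hyN hy

lemma IsStage.covers_or_exists_next (h : IsStage A C H) (hG : Group.IsNilpotent G)
    (hA : IsApproximateSubgroup K A) (hfin : A.Finite) {p : ℕ} (hp : HasSeparated A 6 H p) :
    Covers (A ^ 2) H C ∨ ∃ C' H', IsStage A C' H' ∧ C' ≤ C ∧ H ≤ H' ∧
      HasSeparated A 6 H' (p + 1) ∧ (cosetCount A C' : ℝ) ≤ cosetCount A C * K ^ 16 ∧
      (Covers (A ^ 4) H H' ∨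
        ∃ N ≤ H', Covers (A ^ 2) H N ∧ ∀ x ∈ H', ∀ c ∈ C', ⁅x, c⁆ ∈ N) := by
  obtain ⟨N, hHN, hN, hcov, hmax⟩ := h.exists_maximal hA hfin
  by_cases hCN : ∀ x ∈ A ^ 2, x ∈ C → x ∈ N
  · left
    have : C ≤ N := hN.le_closure_sup.trans
      (sup_le ((Subgroup.closure_le _).2 fun x hx => hCN x hx.1 hx.2) le_rfl)
    exact fun x hx => hcov x (this hx)
  right
  push Not at hCN
  obtain ⟨x, hxA, hxC, hxN⟩ := hCN
  obtain ⟨j, ⟨y, hyA, hyC, hyj, hyN⟩, hj⟩ := exists_lowerCentralSeries_index hG hxA hxC hxN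
  by_cases hg : ∃ g ∈ A ^ 6, g ∈ C ∧ g ∈ γ j ⊔ N ∧ ∀ w ∈ N, g * w⁻¹ ∉ A ^ 2
  · obtain ⟨g, hgA, hgC, hgj, hgN⟩ := hg
    obtain ⟨C', H', hstage, hC', hNH', hgH', hcomm, hcount⟩ :=
      hN.exists_central_extension hA hfin hj hgA hgC hgj
    exact ⟨C', H', hstage, hC', hHN.trans hNH', (hp.mono hHN).succ hA hNH' hgA hgH' hgN, hcount,
      Or.inr ⟨N, hNH', hcov, hcomm⟩⟩
  · push Not at hg
    obtain ⟨P, hNP, hPC, hP, hcovP, hPj⟩ := hN.exists_covered_extension hA hg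
    have hHP : Covers (A ^ 4) H P := hcov.trans hcovP
    have hnot : ¬ Covers (A ^ 2) H P := fun hc => hyN (hmax P hNP hPC hP hc (hPj y hyA hyC hyj))
    simp only [Covers, not_forall, not_exists, not_and] at hnot
    obtain ⟨z, hz, hzH⟩ := hnot
    obtain ⟨w, hw, hzw⟩ := hHP z hz
    have hHP' : H ≤ P := hHN.trans hNP
    refine ⟨C, P, ⟨hPC, hP, h.le_closure_sup.trans (sup_le_sup_left hHP' _),
      hHP.le_closure hA (by norm_num) hHP' h.le_closure⟩, le_rfl, hHP',
      hp.succ hA hHP' (x := z * w⁻¹) (mem_pow_mono hA (by norm_num) hzw)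
        (P.mul_mem hz (P.inv_mem (hHP' hw))) ?_, ?_, Or.inl hHP⟩
    · intro v hv hmem
      exact hzH (v * w) (H.mul_mem hv hw) (by simpa [mul_assoc] using hmem)
    · exact le_mul_of_one_le_right (Nat.cast_nonneg _) (one_le_pow₀ hA.one_le)

lemma normalizes_lowerCentralSeries (C : Subgroup G) (s : ℕ) :
    Normalizes C (C.lowerCentralSeries s) := fun _ hc x hx =>
  (Subgroup.mem_normalizer_iff.1 (C.self_le_normalizer_lowerCentralSeries s hc) x).1 hx

lemma Normalizes.mem_sup (hN : Normalizes C N) (hMC : M ≤ C) {x : G} (hx : x ∈ M ⊔ N) :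
    ∃ y ∈ M, ∃ z ∈ N, y * z = x := by
  have hle : M ≤ Subgroup.normalizer (N : Set G) := by
    refine fun c hc => Subgroup.mem_normalizer_iff.2 fun x => ⟨hN c (hMC hc) x, fun hx => ?_⟩
    simpa [mul_assoc] using hN c⁻¹ (C.inv_mem (hMC hc)) _ hx
  rw [← SetLike.mem_coe, Subgroup.coe_mul_of_left_le_normalizer_right M N hle] at hx
  exact hx

lemma Normalizes.sup (hM : Normalizes C M) (hN : Normalizes C N) (hMC : M ≤ C) :
    Normalizes C (M ⊔ N) := by
  intro c hc x hx
  obtain ⟨y, hy, z, hz, rfl⟩ := hN.mem_sup hMC hx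
  convert Subgroup.mul_mem_sup (hM c hc y hy) (hN c hc z hz) using 1
  group

lemma Normalizes.anti (h : Normalizes C N) (hMC : M ≤ C) : Normalizes M N :=
  fun c hc => h c (hMC hc)

universe u

lemma exists_covers_lowerCentralSeries (K : ℝ) (n : ℕ) : ∃ t : ℕ, ∀ (G : Type u) [Group G],
    Group.IsNilpotent G → ∀ (A : Set G), IsApproximateSubgroup K A → A.Finite →
      ∀ (C H : Subgroup G) (p : ℕ), IsStage A C H → HasSeparated A 6 H p → ⌊K ^ 6⌋₊ ≤ p + n →
        ∃ C' : Subgroup G, H ≤ C' ∧ C' ≤ C ∧ C' ≤ Subgroup.closure (A ^ 6 ∩ (C' : Set G)) ∧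
          (cosetCount A C' : ℝ) ≤ cosetCount A C * K ^ (16 * n) ∧
          ∃ s ≤ n, Covers (A ^ t) H (C'.lowerCentralSeries s) := by
  induction n with
  | zero =>
    refine ⟨2, fun G _ hG A hA hfin C H p h hp hn => ?_⟩
    rcases h.covers_or_exists_next hG hA hfin hp with hcov | ⟨C', H', -, -, -, hp', -⟩
    · exact ⟨C, h.le, le_rfl, hcov.le_closure hA (by norm_num) h.le h.le_closure, by simp, 0,
        le_rfl, hcov⟩
    · have := hp'.le_floor hA hfin
      omega
  | succ n ih =>
    obtain ⟨t, ht⟩ := ih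
    obtain ⟨u, hu⟩ : ∃ u, u = t + 6 + t + 6 := ⟨_, rfl⟩
    refine ⟨(u + u) * ⌊K ^ (u + u)⌋₊ + u + 2, fun G _ hG A hA hfin C H p h hp hn => ?_⟩
    rcases h.covers_or_exists_next hG hA hfin hp with
      hcov | ⟨C', H', h', hCC', hHH', hp', hcount, hnext⟩
    · refine ⟨C, h.le, le_rfl, hcov.le_closure hA (by norm_num) h.le h.le_closure, ?_, 0,
        Nat.zero_le _, hcov.mono_pow hA (by omega)⟩
      exact le_mul_of_one_le_right (Nat.cast_nonneg _) (one_le_pow₀ hA.one_le)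
    obtain ⟨C'', hH', hC', hgen, hcount', s, hs, hcov⟩ :=
      ht G hG A hA hfin C' H' (p + 1) h' hp' (by omega)
    refine ⟨C'', hHH'.trans hH', hC'.trans hCC', hgen, ?_, ?_⟩
    · refine hcount'.trans ((mul_le_mul_of_nonneg_right hcount
        (pow_nonneg (zero_le_one.trans hA.one_le) _)).trans_eq ?_)
      ring
    rcases hnext with hcov' | ⟨N, -, hHN, hcomm⟩
    · exact ⟨s, hs.trans n.le_succ, (hcov'.trans hcov).mono_pow hA (by omega)⟩
    have hnorm : Normalizes C'' H' := h'.normalizes.anti hC'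
    have hs_le : C''.lowerCentralSeries s ≤ C'' := C''.lowerCentralSeries_le_self s
    have hcov_sup : Covers (A ^ t) H' (C''.lowerCentralSeries s ⊔ H') := by
      intro x hx
      obtain ⟨y, hy, z, hz, rfl⟩ := hnorm.mem_sup hs_le hx
      obtain ⟨w, hw, hyw⟩ := hcov y hy
      refine ⟨w * z, H'.mul_mem hw hz, by simpa [mul_assoc] using hyw⟩
    have hcov_comm := Covers.commutator hA hfin hG hu hgen le_sup_right (sup_le hs_le hH') hnorm
      ((normalizes_lowerCentralSeries C'' s).sup hnorm hs_le) hcov_sup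
    have hle : ⁅H', C''⁆ ≤ N := Subgroup.commutator_le.2 fun x hx c hc => hcomm x hx c (hC' hc)
    refine ⟨s + 1, by omega, hHN.trans fun x hx => ?_⟩
    obtain ⟨w, hw, hxw⟩ := hcov_comm x (Subgroup.commutator_mono le_sup_left le_rfl hx)
    exact ⟨w, hle hw, hxw⟩

lemma _root_.IsKApproximateSubgroup.isApproximateSubgroup (h : IsKApproximateSubgroup K A) :
    IsApproximateSubgroup K A := by
  obtain ⟨-, hinv, hone, X, hX, hcard, hsub⟩ := h
  exact ⟨hone, hinv, hX.toFinset, by rwa [← Set.ncard_eq_toFinset_card X hX],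
    by simpa [sq] using hsub⟩

lemma upperCentralSeries_quotient_eq_top {s n : ℕ} (hsn : s ≤ n) {N : Subgroup C} [N.Normal]
    (h : (C.lowerCentralSeries s).subgroupOf C ≤ N) :
    Subgroup.upperCentralSeries (C ⧸ N) n = ⊤ := by
  rw [← Subgroup.lowerCentralSeries_eq_bot_iff_upperCentralSeries_eq_top, eq_bot_iff]
  refine (Subgroup.lowerCentralSeries_antitone _ hsn).trans ?_
  have hmap := Subgroup.map_lowerCentralSeries (⊤ : Subgroup C) (QuotientGroup.mk' N) s
  rw [Subgroup.map_top_of_surjective _ (QuotientGroup.mk'_surjective N)] at hmap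
  rw [← hmap, Subgroup.map_le_iff_le_comap, MonoidHom.comap_bot, QuotientGroup.ker_mk']
  refine le_trans (fun x hx => ?_) h
  rw [Subgroup.mem_subgroupOf, ← Subgroup.top_subtype_lowerCentralSeries]
  exact ⟨x, hx, rfl⟩

lemma exists_subset_mul_inter (hA : IsApproximateSubgroup K A) (hfin : A.Finite)
    (C : Subgroup G) : ∃ X : Set G, X.Finite ∧ X.ncard = cosetCount A C ∧
      A ⊆ X * (A ^ 2 ∩ (C : Set G)) := by
  obtain ⟨Y, hYA, hY⟩ := Set.exists_subset_bijOn A (fun x : G => (x : G ⧸ C))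
  refine ⟨Y, hfin.subset hYA, by rw [cosetCount, ← hY.image_eq, hY.injOn.ncard_image], ?_⟩
  intro a ha
  obtain ⟨y, hy, hya⟩ := hY.surjOn ⟨a, ha, rfl⟩
  refine ⟨y, hy, y⁻¹ * a, ⟨?_, QuotientGroup.eq.1 hya⟩, by simp⟩
  rw [sq]
  exact Set.mul_mem_mul (by rw [← hA.inv_eq_self]; simpa using hYA hy) ha

lemma pow_le_exp_rpow {n : ℕ} (hK : 1 ≤ K) (hn : n ≤ ⌊K ^ 6⌋₊) :
    K ^ (16 * n) ≤ Real.exp (K ^ (22 : ℝ)) := by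
  have hK₀ : 0 < K := zero_lt_one.trans_le hK
  have hn' : (n : ℝ) ≤ K ^ 6 := (Nat.le_floor_iff (by positivity)).1 hn
  have hlog : Real.log (K ^ 16) ≤ K ^ 16 := Real.log_le_self (by positivity)
  rw [show (22 : ℝ) = (22 : ℕ) by norm_num, Real.rpow_natCast, ← Real.log_le_iff_le_exp
    (by positivity), pow_mul, Real.log_pow]
  calc (n : ℝ) * Real.log (K ^ 16) ≤ n * K ^ 16 := by gcongr
    _ ≤ K ^ 6 * K ^ 16 := by gcongr
    _ = K ^ 22 := by ring

end ApproximateSubgroup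

theorem statement_17 :
    ∃ (c : ℝ) (m : ℝ → ℕ), 0 < c ∧
      ∀ (G : Type*) [Group G], Group.IsNilpotent G →
        ∀ K : ℝ, 1 ≤ K → ∀ A : Set G, IsKApproximateSubgroup K A →
          ∃ (H C : Subgroup G), H ≤ C ∧
            ∃ _ : (H.subgroupOf C).Normal,
              -- (a) H ⊆ A^{m(K)}
              (H : Set G) ⊆ A ^ m K ∧
              -- (b) C/H is nilpotent of class at most K⁶
              upperCentralSeries (↥C ⧸ H.subgroupOf C) ⌊K ^ 6⌋₊ = ⊤ ∧
              -- (c) C is generated by A⁶ ∩ C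
              C = Subgroup.closure (A ^ 6 ∩ (C : Set G)) ∧
              -- (d) |A² ∩ C| ≥ exp(-K^c)·|A|
              Real.exp (-K ^ c) * (A.ncard : ℝ) ≤ ((A ^ 2 ∩ (C : Set G)).ncard : ℝ) ∧
              -- (e) A is covered by at most exp(K^c) left cosets of C
              ∃ X : Set G, X.Finite ∧ (X.ncard : ℝ) ≤ Real.exp (K ^ c) ∧
                A ⊆ X * (C : Set G) := by
  choose m hm using fun K : ℝ => ApproximateSubgroup.exists_covers_lowerCentralSeries K ⌊K ^ 6⌋₊
  refine ⟨22, m, by norm_num, fun G _ hG K hK A hA => ?_⟩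
  have hA' := hA.isApproximateSubgroup
  have hfin : A.Finite := hA.1
  have hone : (1 : G) ∈ A ^ 6 := Set.one_mem_pow hA.2.2.1
  have hstage : ApproximateSubgroup.IsStage A (Subgroup.closure A) ⊥ :=
    { le := bot_le
      normalizes := by
        rintro c - x rfl
        simp
      le_closure_sup := le_sup_of_le_left <| (Subgroup.closure_le _).2 fun x hx =>
        Subgroup.subset_closure ⟨Set.subset_pow hA.2.2.1 two_ne_zero hx,
          Subgroup.subset_closure hx⟩
      le_closure := bot_le }
  have hsep : ApproximateSubgroup.HasSeparated A 6 ⊥ 1 :=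
    ⟨{1}, by simp, by simpa using hone, by simp⟩
  obtain ⟨C, -, -, hgen, hcount, s, hs, hcov⟩ :=
    hm K G hG A hA' hfin _ _ 1 hstage hsep (Nat.le_add_left _ _)
  have hcount₁ : ApproximateSubgroup.cosetCount A (Subgroup.closure A) ≤ 1 := by
    refine (Set.ncard_le_one_iff (hfin.image _)).2 ?_
    rintro _ _ ⟨a, ha, rfl⟩ ⟨b, hb, rfl⟩
    exact QuotientGroup.eq.2 (Subgroup.mul_mem _
      (Subgroup.inv_mem _ (Subgroup.subset_closure ha)) (Subgroup.subset_closure hb))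
  obtain ⟨X, hX, hXcard, hAX⟩ := ApproximateSubgroup.exists_subset_mul_inter hA' hfin C
  have hXle : (X.ncard : ℝ) ≤ Real.exp (K ^ (22 : ℝ)) := by
    rw [hXcard]
    refine hcount.trans (le_trans ?_ (ApproximateSubgroup.pow_le_exp_rpow hK le_rfl))
    exact mul_le_of_le_one_left (by positivity) (by exact_mod_cast hcount₁)
  have hnormal : ((C.lowerCentralSeries s).subgroupOf C).Normal := ⟨fun x hx c =>
    ApproximateSubgroup.normalizes_lowerCentralSeries C s c c.2 x hx⟩
  refine ⟨C.lowerCentralSeries s, C, C.lowerCentralSeries_le_self s, hnormal, ?_,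
    ApproximateSubgroup.upperCentralSeries_quotient_eq_top hs le_rfl,
    le_antisymm hgen ((Subgroup.closure_le _).2 Set.inter_subset_right), ?_, X, hX, hXle,
    hAX.trans (Set.mul_subset_mul_left Set.inter_subset_right)⟩
  · intro x hx
    obtain ⟨w, rfl, hxw⟩ := hcov x hx
    simpa using hxw
  · have hfin₂ : (A ^ 2 ∩ (C : Set G)).Finite :=
      (ApproximateSubgroup.finite_pow hfin 2).subset Set.inter_subset_left
    have hcard : (A.ncard : ℝ) ≤ X.ncard * (A ^ 2 ∩ (C : Set G)).ncard := by
      exact_mod_cast (Set.ncard_le_ncard hAX (hX.mul hfin₂)).trans Set.natCard_mul_le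
    rw [Real.exp_neg, inv_mul_le_iff₀ (Real.exp_pos _)]
    exact hcard.trans (by gcongr)
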